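/- Shearer-type bound for light intersections: Let X be a random tuple of n queries, F a uniformly random function independent of (X,Y), T = {i : X_i ∈ Y} the random index set of intersection queries, and M₁ a (randomized) function of (X, F(X)) with |M₁| bits. If for every x and every index i, P[ i ∈ T | X = x ] ≤ δ, and Y is independent of (F, M₁) given X, then I( M₁ ; F(X_T) | T, X ) ≤ δ·|M₁|. -/

import Mathlib

open scoped BigOperators Classical

noncomputable section

variable {Ω : Type*} [Fintype Ω]

/-- Probability of an event under a mass function `μ`. -/
def prEv (μ : Ω → ℝ) (E : Ω → Prop) : ℝ := ∑ ω, if E ω then μ ω else 0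

/-- Distribution (pmf) of a random variable. -/
def rvDist (μ : Ω → ℝ) {α : Type*} (X : Ω → α) : α → ℝ :=
  fun a => prEv μ (fun ω => X ω = a)

/-- Conditional distribution of `X` given the event `B = b`. -/
def condDist (μ : Ω → ℝ) {α β : Type*} (X : Ω → α) (B : Ω → β) (b : β) : α → ℝ :=
  fun a => prEv μ (fun ω => X ω = a ∧ B ω = b) / prEv μ (fun ω => B ω = b)

/-- Product of two distributions. -/
def prodDist {α β : Type*} (P : α → ℝ) (Q : β → ℝ) : α × β → ℝ := fun p => P p.1 * Q p.2

/-- Statistical (total variation) distance between two distributions on a finite set. -/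
def SD {α : Type*} [Fintype α] (P Q : α → ℝ) : ℝ := (1/2) * ∑ a, |P a - Q a|

/-- Shannon entropy (base 2) of a distribution, with the convention `0 · log(1/0) = 0`. -/
def H2 {α : Type*} [Fintype α] (P : α → ℝ) : ℝ :=
  ∑ a, if P a = 0 then 0 else P a * Real.logb 2 (1 / P a)

/-- Shannon entropy of a random variable. -/
def entRV (μ : Ω → ℝ) {α : Type*} [Fintype α] (X : Ω → α) : ℝ := H2 (rvDist μ X)

/-- Conditional mutual information `I(A;B|C)` (in bits). -/
def condMI (μ : Ω → ℝ) {α β γ : Type*} [Fintype α] [Fintype β] [Fintype γ]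
    (A : Ω → α) (B : Ω → β) (C : Ω → γ) : ℝ :=
  entRV μ (fun ω => (A ω, C ω)) + entRV μ (fun ω => (B ω, C ω))
    - entRV μ (fun ω => (A ω, B ω, C ω)) - entRV μ C

/-- The conditional probability measure given `Z = z`. -/
def condMeas (μ : Ω → ℝ) {ζ : Type*} (Z : Ω → ζ) (z : ζ) : Ω → ℝ :=
  fun ω => if Z ω = z then μ ω / prEv μ (fun ω' => Z ω' = z) else 0

/-- `μ` is a probability mass function. -/
def IsPMF (μ : Ω → ℝ) : Prop := (∀ ω, 0 ≤ μ ω) ∧ ∑ ω, μ ω = 1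

end
open scoped BigOperators Classical

theorem aux_sum_fiber {Ω α : Type*} [Fintype Ω] [Fintype α] (ν : Ω → ℝ) (A : Ω → α) (h : α → ℝ) :
    ∑ ω, ν ω * h (A ω) = ∑ a, prEv ν (fun ω => A ω = a) * h a := by
  unfold prEv
  simp_rw [Finset.sum_mul]
  rw [Finset.sum_comm]
  refine Finset.sum_congr rfl fun ω _ => ?_
  rw [Finset.sum_eq_single (A ω)]
  · simp
  · intro b _ hb
    rw [if_neg (fun h => hb h.symm), zero_mul]
  · simp

theorem aux_pr_nonneg {Ω : Type*} [Fintype Ω] {ν : Ω → ℝ} (hν : ∀ ω, 0 ≤ ν ω) (E : Ω → Prop) :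
    0 ≤ prEv ν E := by
  unfold prEv
  refine Finset.sum_nonneg fun ω _ => ?_
  split_ifs
  · exact hν ω
  · exact le_rfl

theorem aux_pr_mono {Ω : Type*} [Fintype Ω] {ν : Ω → ℝ} (hν : ∀ ω, 0 ≤ ν ω) {E E' : Ω → Prop}
    (h : ∀ ω, E ω → E' ω) : prEv ν E ≤ prEv ν E' := by
  unfold prEv
  refine Finset.sum_le_sum fun ω _ => ?_
  by_cases h1 : E ω
  · rw [if_pos h1, if_pos (h ω h1)]
  · rw [if_neg h1]
    split_ifs
    · exact hν ω
    · exact le_rfl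

theorem aux_pr_pos {Ω : Type*} [Fintype Ω] {ν : Ω → ℝ} (hν : ∀ ω, 0 ≤ ν ω) {E : Ω → Prop}
    (ω : Ω) (h : 0 < ν ω) (hE : E ω) : 0 < prEv ν E := by
  unfold prEv
  refine Finset.sum_pos' (fun ω _ => ?_) ⟨ω, Finset.mem_univ _, ?_⟩
  · split_ifs
    · exact hν ω
    · exact le_rfl
  · rwa [if_pos hE]

theorem aux_pr_congr {Ω : Type*} [Fintype Ω] (ν : Ω → ℝ) {E E' : Ω → Prop}
    (h : ∀ ω, E ω ↔ E' ω) : prEv ν E = prEv ν E' := by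
  rw [show E = E' from funext fun ω => propext (h ω)]

theorem aux_pr_sum {Ω α : Type*} [Fintype Ω] [Fintype α] (ν : Ω → ℝ) (A : Ω → α) (E : Ω → Prop) :
    ∑ a, prEv ν (fun ω => A ω = a ∧ E ω) = prEv ν E := by
  unfold prEv
  rw [Finset.sum_comm]
  refine Finset.sum_congr rfl fun ω _ => ?_
  rw [Finset.sum_eq_single (A ω)]
  · simp
  · intro b _ hb
    rw [if_neg (fun h => hb h.1.symm)]
  · simp

theorem aux_pr_true {Ω : Type*} [Fintype Ω] (ν : Ω → ℝ) : prEv ν (fun _ => True) = ∑ ω, ν ω := by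
  simp [prEv]

/-- negative entropy (nats) in pointwise form -/
noncomputable def auxN {Ω α : Type*} [Fintype Ω] (ν : Ω → ℝ) (A : Ω → α) : ℝ :=
  ∑ ω, ν ω * Real.log (prEv ν (fun ω' => A ω' = A ω))

theorem auxN_congr {Ω α β : Type*} [Fintype Ω] (ν : Ω → ℝ) (A : Ω → α) (B : Ω → β)
    (h : ∀ ω ω', A ω' = A ω ↔ B ω' = B ω) : auxN ν A = auxN ν B := by
  unfold auxN
  refine Finset.sum_congr rfl fun ω _ => ?_
  rw [aux_pr_congr ν (h ω)]

theorem aux_entRV {Ω α : Type*} [Fintype Ω] [Fintype α] (ν : Ω → ℝ) (A : Ω → α) :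
    entRV ν A * Real.log 2 = - auxN ν A := by
  have h2 : Real.log 2 ≠ 0 := (Real.log_pos one_lt_two).ne'
  have := aux_sum_fiber ν A (fun a => Real.log (prEv ν (fun ω' => A ω' = a)))
  unfold auxN
  rw [this]
  unfold entRV H2 rvDist
  rw [Finset.sum_mul, ← Finset.sum_neg_distrib]
  refine Finset.sum_congr rfl fun a _ => ?_
  split_ifs with h0
  · rw [h0]; simp
  · rw [Real.logb, one_div, Real.log_inv]
    field_simp

theorem aux_condMI {Ω α β γ : Type*} [Fintype Ω] [Fintype α] [Fintype β] [Fintype γ] (ν : Ω → ℝ)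
    (A : Ω → α) (B : Ω → β) (C : Ω → γ) :
    condMI ν A B C * Real.log 2 = auxN ν (fun ω => (A ω, B ω, C ω)) + auxN ν C
      - auxN ν (fun ω => (A ω, C ω)) - auxN ν (fun ω => (B ω, C ω)) := by
  unfold condMI
  rw [sub_mul, sub_mul, add_mul, aux_entRV, aux_entRV, aux_entRV, aux_entRV]
  ring

theorem aux_submod {Ω α β γ : Type*} [Fintype Ω] [Fintype α] [Fintype β] [Fintype γ] {ν : Ω → ℝ}
    (hν : ∀ ω, 0 ≤ ν ω) (A : Ω → α) (B : Ω → β) (C : Ω → γ) :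
    0 ≤ auxN ν (fun ω => (A ω, B ω, C ω)) + auxN ν C
      - auxN ν (fun ω => (A ω, C ω)) - auxN ν (fun ω => (B ω, C ω)) := by
  set p3 : α × β × γ → ℝ := fun t => prEv ν (fun ω => (A ω, B ω, C ω) = t) with hp3
  set pa : α → γ → ℝ := fun a c => prEv ν (fun ω => (A ω, C ω) = (a, c)) with hpa
  set pb : β → γ → ℝ := fun b c => prEv ν (fun ω => (B ω, C ω) = (b, c)) with hpb
  set pc : γ → ℝ := fun c => prEv ν (fun ω => C ω = c) with hpc
  have hpa0 : ∀ a c, 0 ≤ pa a c := fun a c => aux_pr_nonneg hν _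
  have hpb0 : ∀ a c, 0 ≤ pb a c := fun a c => aux_pr_nonneg hν _
  have hpc0 : ∀ c, 0 ≤ pc c := fun c => aux_pr_nonneg hν _
  have hp30 : ∀ c, 0 ≤ p3 c := fun c => aux_pr_nonneg hν _
  set K : α × β × γ → ℝ := fun t => pa t.1 t.2.2 * pb t.2.1 t.2.2 / (p3 t * pc t.2.2) with hK
  have key : ∑ ω, ν ω * K (A ω, B ω, C ω) ≤ ∑ ω, ν ω := by
    rw [aux_sum_fiber ν (fun ω => (A ω, B ω, C ω)) K]
    have h1 : ∀ t : α × β × γ, prEv ν (fun ω => (A ω, B ω, C ω) = t) * K t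
        ≤ pa t.1 t.2.2 * pb t.2.1 t.2.2 / pc t.2.2 := by
      intro t
      change p3 t * _ ≤ _
      by_cases h0 : p3 t = 0
      · rw [h0, zero_mul]
        exact div_nonneg (mul_nonneg (hpa0 _ _) (hpb0 _ _)) (hpc0 _)
      · refine le_of_eq ?_
        simp only [hK]
        rw [← mul_div_assoc, mul_div_mul_left _ _ h0]
    refine (Finset.sum_le_sum fun t _ => h1 t).trans ?_
    have hsa : ∀ c, ∑ a, pa a c = pc c := by
      intro c
      simp only [hpc, hpa, Prod.mk.injEq]
      exact aux_pr_sum ν A (fun ω => C ω = c)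
    have hsb : ∀ c, ∑ a, pb a c = pc c := by
      intro c
      simp only [hpc, hpb, Prod.mk.injEq]
      exact aux_pr_sum ν B (fun ω => C ω = c)
    have hsc : ∑ c, pc c = ∑ ω, ν ω := by
      rw [← aux_pr_true ν, ← aux_pr_sum ν C]
      simp [hpc]
    rw [← hsc, Fintype.sum_prod_type]
    simp_rw [Fintype.sum_prod_type]
    simp_rw [Finset.sum_comm (s := (Finset.univ : Finset β))]
    rw [Finset.sum_comm]
    refine Finset.sum_le_sum fun c _ => ?_
    simp_rw [← Finset.sum_div, ← Finset.mul_sum, ← Finset.sum_mul]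
    rw [hsa, hsb]
    by_cases h0 : pc c = 0
    · rw [h0]; simp
    · rw [mul_div_assoc, div_self h0, mul_one]
  unfold auxN
  rw [← Finset.sum_add_distrib, ← Finset.sum_sub_distrib, ← Finset.sum_sub_distrib]
  have : ∑ ω, (ν ω - ν ω * K (A ω, B ω, C ω)) ≤ _ := Finset.sum_le_sum (s := Finset.univ)
    (g := fun ω => ν ω * Real.log (prEv ν (fun ω' => (A ω', B ω', C ω') = (A ω, B ω, C ω)))
      + ν ω * Real.log (prEv ν (fun ω' => C ω' = C ω))
      - ν ω * Real.log (prEv ν (fun ω' => (A ω', C ω') = (A ω, C ω)))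
      - ν ω * Real.log (prEv ν (fun ω' => (B ω', C ω') = (B ω, C ω)))) (fun ω _ => by
      rcases (hν ω).eq_or_lt with h | h
      · rw [← h]; simp
      · have e3 : 0 < p3 (A ω, B ω, C ω) := aux_pr_pos hν ω h rfl
        have ea : 0 < pa (A ω) (C ω) := aux_pr_pos hν ω h rfl
        have eb : 0 < pb (B ω) (C ω) := aux_pr_pos hν ω h rfl
        have ec : 0 < pc (C ω) := aux_pr_pos hν ω h rfl
        have hKp : 0 < K (A ω, B ω, C ω) := by simp only [hK]; positivity
        have hl := Real.log_le_sub_one_of_pos hKp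
        have hl2 : Real.log (K (A ω, B ω, C ω)) = Real.log (pa (A ω) (C ω))
            + Real.log (pb (B ω) (C ω)) - (Real.log (p3 (A ω, B ω, C ω)) + Real.log (pc (C ω))) := by
          simp only [hK]
          rw [Real.log_div (by positivity) (by positivity), Real.log_mul ea.ne' eb.ne',
            Real.log_mul e3.ne' ec.ne']
        rw [hl2] at hl
        change _ ≤ ν ω * Real.log (p3 (A ω, B ω, C ω)) + ν ω * Real.log (pc (C ω))
          - ν ω * Real.log (pa (A ω) (C ω)) - ν ω * Real.log (pb (B ω) (C ω))
        nlinarith [mul_le_mul_of_nonneg_left hl h.le])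
  rw [Finset.sum_sub_distrib] at this
  linarith

theorem aux_ent_le {Ω α : Type*} [Fintype Ω] [Fintype α] {ν : Ω → ℝ}
    (hν : ∀ ω, 0 ≤ ν ω) (A : Ω → α) :
    (∑ ω, ν ω) * Real.log (∑ ω, ν ω) - auxN ν A ≤ (∑ ω, ν ω) * Real.log (Fintype.card α) := by
  set p := ∑ ω, ν ω with hp
  set k : ℝ := (Fintype.card α : ℝ) with hk
  have hp0 : 0 ≤ p := Finset.sum_nonneg fun ω _ => hν ω
  have hk0 : 0 ≤ k := Nat.cast_nonneg _
  have key : ∑ ω, ν ω * (p / (prEv ν (fun ω' => A ω' = A ω) * k)) ≤ p := by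
    rw [aux_sum_fiber ν A (fun a => p / (prEv ν (fun ω' => A ω' = a) * k))]
    have : ∀ a, prEv ν (fun ω' => A ω' = a) * (p / (prEv ν (fun ω' => A ω' = a) * k)) ≤ p / k := by
      intro a
      by_cases h0 : prEv ν (fun ω' => A ω' = a) = 0
      · rw [h0, zero_mul]; positivity
      · rw [← mul_div_assoc, mul_div_mul_left _ _ h0]
    refine (Finset.sum_le_sum fun a _ => this a).trans ?_
    rw [Finset.sum_const, Finset.card_univ, nsmul_eq_mul]
    change k * (p / k) ≤ p
    by_cases h0 : k = 0
    · rw [h0, zero_mul]; exact hp0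
    · rw [mul_div_cancel₀ _ h0]
  have : ∑ ω, (ν ω * Real.log p - ν ω * Real.log (prEv ν (fun ω' => A ω' = A ω))
      - ν ω * Real.log k) ≤
      ∑ ω, (ν ω * (p / (prEv ν (fun ω' => A ω' = A ω) * k)) - ν ω) := by
    refine Finset.sum_le_sum fun ω _ => ?_
    rcases (hν ω).eq_or_lt with h | h
    · rw [← h]; simp
    · have ea : 0 < prEv ν (fun ω' => A ω' = A ω) := aux_pr_pos hν ω h rfl
      have ep : 0 < p := by
        rw [hp, ← aux_pr_true]; exact aux_pr_pos hν ω h trivial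
      have ek : 0 < k := by
        rw [hk]; exact_mod_cast Fintype.card_pos_iff.mpr ⟨A ω⟩
      have hl := Real.log_le_sub_one_of_pos
        (show 0 < p / (prEv ν (fun ω' => A ω' = A ω) * k) by positivity)
      rw [Real.log_div ep.ne' (by positivity), Real.log_mul ea.ne' ek.ne'] at hl
      nlinarith [mul_le_mul_of_nonneg_left hl h.le]
  rw [Finset.sum_sub_distrib, Finset.sum_sub_distrib, Finset.sum_sub_distrib, ← Finset.sum_mul,
    ← Finset.sum_mul] at this
  unfold auxN
  linarith

theorem aux_shearer {Ω Q : Type*} [Fintype Ω] [Fintype Q] (w : Ω → ℝ) (hw : ∀ ω, 0 ≤ w ω)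
    (S : Ω → Finset Q) (δ : ℝ) (hS : ∀ q, prEv w (fun ω => q ∈ S ω) ≤ δ)
    (g : Finset Q → ℝ) (g0 : g ∅ = 0)
    (gmono : ∀ i A, i ∉ A → g A ≤ g (insert i A))
    (gsup : ∀ i A A', i ∉ A → A' ⊆ A → g (insert i A') - g A' ≤ g (insert i A) - g A) :
    ∑ ω, w ω * g (S ω) ≤ δ * g Finset.univ := by
  have main : ∀ A : Finset Q, ∑ ω, w ω * g (S ω ∩ A) ≤ δ * g A := by
    intro A
    induction A using Finset.induction_on with
    | empty => simp [g0]
    | insert i A hi ih =>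
      have h1 : ∀ ω, w ω * g (S ω ∩ insert i A) ≤ w ω * g (S ω ∩ A)
          + (if i ∈ S ω then w ω else 0) * (g (insert i A) - g A) := by
        intro ω
        by_cases h : i ∈ S ω
        · rw [if_pos h, Finset.inter_insert_of_mem h]
          have := gsup i A (S ω ∩ A) hi Finset.inter_subset_right
          nlinarith [mul_le_mul_of_nonneg_left this (hw ω)]
        · rw [if_neg h, Finset.inter_insert_of_notMem h]
          simp
      refine (Finset.sum_le_sum fun ω _ => h1 ω).trans ?_
      rw [Finset.sum_add_distrib, ← Finset.sum_mul]
      have h2 := hS i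
      unfold prEv at h2
      have h3 := mul_le_mul_of_nonneg_right h2 (sub_nonneg.mpr (gmono i A hi))
      have h4 : (∑ ω, if i ∈ S ω then w ω else 0) * (g (insert i A) - g A)
        ≤ δ * (g (insert i A) - g A) := by
        refine le_trans (le_of_eq ?_) h3
        congr 1
        refine Finset.sum_congr rfl fun ω _ => ?_
        by_cases h : i ∈ S ω <;> simp [h]
      linarith
  have := main Finset.univ
  simpa using this

noncomputable def auxR {Q Ans : Type*} (S : Finset Q) (f : Q → Ans) : Q → Option Ans :=
  fun q => if q ∈ S then some (f q) else none

theorem auxR_eq {Q Ans : Type*} (S : Finset Q) (f f' : Q → Ans) :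
    auxR S f = auxR S f' ↔ ∀ q ∈ S, f q = f' q := by
  unfold auxR
  constructor
  · intro h q hq
    have := congrFun h q
    simpa [hq] using this
  · intro h
    funext q
    by_cases hq : q ∈ S
    · simp [hq, h q hq]
    · simp [hq]

theorem aux_unif {Ω Q Ans : Type*} [Fintype Ω] [Fintype Q] [Fintype Ans] (ν : Ω → ℝ)
    (F : Ω → Q → Ans) (c : ℝ) (hu : ∀ f, prEv ν (fun ω => F ω = f) = c) (S : Finset Q)
    (f0 : Q → Ans) :
    prEv ν (fun ω => auxR S (F ω) = auxR S f0)
      = c * (Fintype.card Ans : ℝ) ^ (Finset.univ.filter (fun q => q ∉ S)).card := by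
  have h := aux_sum_fiber ν F (fun f => if auxR S f = auxR S f0 then (1:ℝ) else 0)
  have h1 : prEv ν (fun ω => auxR S (F ω) = auxR S f0)
      = ∑ ω, ν ω * (if auxR S (F ω) = auxR S f0 then (1:ℝ) else 0) := by
    unfold prEv
    refine Finset.sum_congr rfl fun ω _ => ?_
    split_ifs <;> simp
  rw [h1, h]
  simp_rw [hu]
  rw [← Finset.mul_sum, Finset.sum_boole]
  congr 1
  have : (Finset.univ.filter (fun f => auxR S f = auxR S f0))
      = Fintype.piFinset (fun q => if q ∈ S then {f0 q} else Finset.univ) := by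
    ext f
    simp only [Finset.mem_filter, Finset.mem_univ, true_and, Fintype.mem_piFinset, auxR_eq]
    refine forall_congr' fun q => ?_
    by_cases hq : q ∈ S <;> simp [hq]
  rw [this, Fintype.card_piFinset]
  have h2 : ∀ q, (if q ∈ S then ({f0 q} : Finset Ans) else Finset.univ).card
      = if q ∈ S then 1 else Fintype.card Ans := by
    intro q; split_ifs <;> simp
  simp_rw [h2]
  rw [Finset.prod_ite]
  simp

theorem aux_g_bound {Ω Q Ans κ : Type*} [Fintype Ω] [Fintype Q] [Fintype Ans] [Fintype κ]
    {ν : Ω → ℝ} (hν : ∀ ω, 0 ≤ ν ω) (F : Ω → Q → Ans) (M : Ω → κ)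
    (c : ℝ) (hu : ∀ f, prEv ν (fun ω => F ω = f) = c)
    (w : Ω → ℝ) (hw : ∀ ω, 0 ≤ w ω)
    (S : Ω → Finset Q) (δ : ℝ) (hδ : 0 ≤ δ) (hS : ∀ q, prEv w (fun ω => q ∈ S ω) ≤ δ) :
    ∑ ω, w ω * (auxN ν (fun ω' => (M ω', auxR (S ω) (F ω'))) + (∑ ω, ν ω) * Real.log (∑ ω, ν ω)
      - auxN ν M - auxN ν (fun ω' => auxR (S ω) (F ω')))
      ≤ δ * ((∑ ω, ν ω) * Real.log (Fintype.card κ)) := by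
  set p := ∑ ω, ν ω with hp
  set g : Finset Q → ℝ := fun A => auxN ν (fun ω' => (M ω', auxR A (F ω'))) + p * Real.log p
      - auxN ν M - auxN ν (fun ω' => auxR A (F ω')) with hg
  have hconst : auxN ν (fun _ => ()) = p * Real.log p := by
    unfold auxN
    rw [hp, Finset.sum_mul]
    refine Finset.sum_congr rfl fun ω _ => ?_
    rw [← aux_pr_true, aux_pr_congr ν (E' := fun _ => True) (fun ω => by simp)]
  have hstep : ∀ i A, i ∉ A → auxN ν (fun ω' => auxR A (F ω'))
      = auxN ν (fun ω' => auxR (insert i A) (F ω')) + p * Real.log (Fintype.card Ans) := by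
    intro i A hi
    unfold auxN
    rw [hp, Finset.sum_mul, ← Finset.sum_add_distrib]
    refine Finset.sum_congr rfl fun ω _ => ?_
    rcases (hν ω).eq_or_lt with h | h
    · rw [← h]; simp
    · have e1 : 0 < prEv ν (fun ω' => auxR (insert i A) (F ω') = auxR (insert i A) (F ω)) :=
        aux_pr_pos hν ω h rfl
      have ek : 0 < (Fintype.card Ans : ℝ) := by
        exact_mod_cast Fintype.card_pos_iff.mpr ⟨F ω i⟩
      have : prEv ν (fun ω' => auxR A (F ω') = auxR A (F ω))
          = prEv ν (fun ω' => auxR (insert i A) (F ω') = auxR (insert i A) (F ω))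
            * (Fintype.card Ans : ℝ) := by
        rw [aux_unif ν F c hu, aux_unif ν F c hu, mul_assoc, ← pow_succ]
        congr 2
        rw [← Finset.card_insert_of_notMem (a := i)
          (s := Finset.univ.filter (fun q => q ∉ insert i A)) (by simp)]
        congr 1
        ext q
        simp only [Finset.mem_filter, Finset.mem_univ, true_and, Finset.mem_insert]
        by_cases hq : q = i
        · subst hq; simp [hi]
        · simp [hq]
      rw [this, Real.log_mul e1.ne' ek.ne']
      ring
  have hfin : ∑ ω, w ω * g (S ω) ≤ δ * g Finset.univ := by
    refine aux_shearer w hw S δ hS g ?_ ?_ ?_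
    · simp only [hg]
      rw [auxN_congr ν (fun ω' => (M ω', auxR ∅ (F ω'))) M (by
          intro ω ω'; simp [auxR_eq]),
        auxN_congr ν (fun ω' => auxR ∅ (F ω')) (fun _ => ()) (by
          intro ω ω'; simp [auxR_eq]), hconst]
      ring
    · intro i A hi
      have h := aux_submod hν M (fun ω => F ω i) (fun ω => auxR A (F ω))
      rw [auxN_congr ν (fun ω => (M ω, F ω i, auxR A (F ω)))
          (fun ω' => (M ω', auxR (insert i A) (F ω'))) (by
          intro ω ω'; simp [auxR_eq]),
        auxN_congr ν (fun ω => (F ω i, auxR A (F ω)))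
          (fun ω' => auxR (insert i A) (F ω')) (by
          intro ω ω'; simp [auxR_eq])] at h
      simp only [hg]
      linarith
    · intro i A A' hi hA
      have h := aux_submod hν (fun ω => F ω i) (fun ω => auxR A (F ω))
        (fun ω => (M ω, auxR A' (F ω)))
      rw [auxN_congr ν (fun ω => (F ω i, auxR A (F ω), M ω, auxR A' (F ω)))
          (fun ω' => (M ω', auxR (insert i A) (F ω'))) (by
          intro ω ω'
          simp only [Prod.mk.injEq, auxR_eq, Finset.forall_mem_insert]
          constructor
          · rintro ⟨a, b, c, d⟩; exact ⟨c, a, b⟩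
          · rintro ⟨c, a, b⟩; exact ⟨a, b, c, fun q hq => b q (hA hq)⟩),
        auxN_congr ν (fun ω => (F ω i, M ω, auxR A' (F ω)))
          (fun ω' => (M ω', auxR (insert i A') (F ω'))) (by
          intro ω ω'
          simp only [Prod.mk.injEq, auxR_eq, Finset.forall_mem_insert]
          tauto),
        auxN_congr ν (fun ω => (auxR A (F ω), M ω, auxR A' (F ω)))
          (fun ω' => (M ω', auxR A (F ω'))) (by
          intro ω ω'
          simp only [Prod.mk.injEq, auxR_eq]
          constructor
          · rintro ⟨b, c, d⟩; exact ⟨c, b⟩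
          · rintro ⟨c, b⟩; exact ⟨b, c, fun q hq => b q (hA hq)⟩)] at h
      have s1 := hstep i A hi
      have s2 := hstep i A' (fun h => hi (hA h))
      simp only [hg]
      linarith
  refine hfin.trans (mul_le_mul_of_nonneg_left ?_ hδ)
  have h1 := aux_ent_le hν M
  have h2 : auxN ν (fun ω' => (M ω', auxR Finset.univ (F ω')))
      ≤ auxN ν (fun ω' => auxR Finset.univ (F ω')) := by
    unfold auxN
    refine Finset.sum_le_sum fun ω _ => ?_
    rcases (hν ω).eq_or_lt with h | h
    · rw [← h]; simp
    · refine mul_le_mul_of_nonneg_left (Real.log_le_log (aux_pr_pos hν ω h rfl)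
        (aux_pr_mono hν fun ω' h' => (Prod.mk.inj h').2)) h.le
  simp only [hg]
  linarith

theorem aux_indep {Ω α β : Type*} [Fintype Ω] [Fintype α] [Fintype β] (ν : Ω → ℝ)
    (U : Ω → α) (V : Ω → β)
    (hi : ∀ u v, prEv ν (fun ω => U ω = u ∧ V ω = v) * (∑ ω, ν ω)
      = prEv ν (fun ω => U ω = u) * prEv ν (fun ω => V ω = v)) (h : α → β → ℝ) :
    (∑ ω, ν ω * h (U ω) (V ω)) * (∑ ω, ν ω) = ∑ ω', ν ω' * ∑ ω, ν ω * h (U ω) (V ω') := by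
  rw [aux_sum_fiber ν (fun ω => (U ω, V ω)) (fun t => h t.1 t.2)]
  rw [aux_sum_fiber ν V (fun v => ∑ ω, ν ω * h (U ω) v)]
  have : ∀ v, ∑ ω, ν ω * h (U ω) v = ∑ u, prEv ν (fun ω => U ω = u) * h u v :=
    fun v => aux_sum_fiber ν U (fun u => h u v)
  simp_rw [this]
  rw [Fintype.sum_prod_type, Finset.sum_comm, Finset.sum_mul]
  refine Finset.sum_congr rfl fun v _ => ?_
  rw [Finset.sum_mul, Finset.mul_sum]
  refine Finset.sum_congr rfl fun u _ => ?_
  have := hi u v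
  simp only [Prod.mk.injEq]
  linear_combination h u v * this

theorem aux_indep_ev {Ω α β : Type*} [Fintype Ω] [Fintype α] [Fintype β] (ν : Ω → ℝ)
    (U : Ω → α) (V : Ω → β)
    (hi : ∀ u v, prEv ν (fun ω => U ω = u ∧ V ω = v) * (∑ ω, ν ω)
      = prEv ν (fun ω => U ω = u) * prEv ν (fun ω => V ω = v)) (E : α → Prop) (E' : β → Prop) :
    prEv ν (fun ω => E (U ω) ∧ E' (V ω)) * (∑ ω, ν ω)
      = prEv ν (fun ω => E (U ω)) * prEv ν (fun ω => E' (V ω)) := by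
  have h := aux_indep ν U V hi (fun u v => (if E u then 1 else 0) * (if E' v then 1 else 0))
  have e1 : prEv ν (fun ω => E (U ω) ∧ E' (V ω)) = ∑ ω, ν ω *
      ((if E (U ω) then 1 else 0) * (if E' (V ω) then 1 else 0)) := by
    unfold prEv
    refine Finset.sum_congr rfl fun ω _ => ?_
    by_cases h1 : E (U ω) <;> by_cases h2 : E' (V ω) <;> simp [h1, h2]
  rw [e1, h]
  unfold prEv
  rw [mul_comm, Finset.sum_mul]
  refine Finset.sum_congr rfl fun ω _ => ?_
  rw [Finset.mul_sum, Finset.mul_sum]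
  refine Finset.sum_congr rfl fun ω' _ => ?_
  split_ifs <;> simp

noncomputable def auxRes {Ω : Type*} (μ : Ω → ℝ) (G : Ω → Prop) : Ω → ℝ :=
  fun ω => if G ω then μ ω else 0

theorem aux_restrict {Ω : Type*} [Fintype Ω] (μ : Ω → ℝ) (G E : Ω → Prop) :
    prEv (auxRes μ G) E = prEv μ (fun ω => E ω ∧ G ω) := by
  unfold prEv auxRes
  refine Finset.sum_congr rfl fun ω _ => ?_
  by_cases h1 : G ω <;> by_cases h2 : E ω <;> simp [h1, h2]

noncomputable def auxS {Q : Type*} {n : ℕ} (x : Fin n → Q) (y : Finset Q) : Finset Q :=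
  y.filter (fun q => ∃ i, x i = q)

theorem auxS_mem {Q : Type*} {n : ℕ} (x : Fin n → Q) (y : Finset Q) (q : Q) :
    q ∈ auxS x y ↔ q ∈ y ∧ ∃ i, x i = q := by
  simp [auxS]

theorem auxS_eq {Q : Type*} {n : ℕ} (x : Fin n → Q) (y y' : Finset Q) :
    Finset.univ.filter (fun i : Fin n => x i ∈ y') = Finset.univ.filter (fun i : Fin n => x i ∈ y)
      ↔ auxS x y' = auxS x y := by
  simp only [Finset.ext_iff, Finset.mem_filter, Finset.mem_univ, true_and, auxS_mem]
  constructor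
  · intro h q
    constructor
    · rintro ⟨h1, i, rfl⟩; exact ⟨(h i).1 h1, i, rfl⟩
    · rintro ⟨h1, i, rfl⟩; exact ⟨(h i).2 h1, i, rfl⟩
  · intro h i
    have := h (x i)
    simpa using this

theorem auxB_eq {Q Ans : Type*} {n : ℕ} (x : Fin n → Q) (y y' : Finset Q) (f f' : Q → Ans)
    (h : auxS x y' = auxS x y) :
    (fun i : Fin n => if x i ∈ y' then some (f' (x i)) else none)
      = (fun i : Fin n => if x i ∈ y then some (f (x i)) else none)
      ↔ auxR (auxS x y) f' = auxR (auxS x y) f := by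
  have h' : ∀ i, x i ∈ y' ↔ x i ∈ y := by
    intro i
    have := Finset.ext_iff.1 h (x i)
    simpa [auxS_mem] using this
  rw [auxR_eq]
  constructor
  · intro hh q hq
    obtain ⟨hy, i, rfl⟩ := (auxS_mem _ _ _).1 hq
    have := congrFun hh i
    simpa [h', hy] using this
  · intro hh
    funext i
    by_cases hy : x i ∈ y
    · simp [h', hy, hh (x i) ((auxS_mem _ _ _).2 ⟨hy, i, rfl⟩)]
    · simp [h', hy]

set_option maxHeartbeats 1000000 in
theorem aux_main {Ω Q Ans κ : Type*} {n : ℕ}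
    [Fintype Ω] [Fintype Q] [Fintype Ans] [Fintype κ]
    (μ : Ω → ℝ) (hμ : IsPMF μ)
    (X : Ω → Fin n → Q) (Y : Ω → Finset Q) (F : Ω → Q → Ans) (M : Ω → κ)
    (δ : ℝ) (hδ : 0 ≤ δ)
    (hF : rvDist μ (fun ω => (F ω, (X ω, Y ω))) =
        prodDist (fun _ => ((Fintype.card (Q → Ans) : ℝ))⁻¹)
          (rvDist μ (fun ω => (X ω, Y ω))))
    (hlight : ∀ (x : Fin n → Q) (i : Fin n),
        prEv μ (fun ω => X ω = x ∧ x i ∈ Y ω) ≤ δ * prEv μ (fun ω => X ω = x))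
    (hcond : ∀ (x : Fin n → Q) (f : Q → Ans) (mm : κ) (y : Finset Q),
        prEv μ (fun ω => F ω = f ∧ M ω = mm ∧ Y ω = y ∧ X ω = x) * prEv μ (fun ω => X ω = x)
          = prEv μ (fun ω => F ω = f ∧ M ω = mm ∧ X ω = x)
            * prEv μ (fun ω => Y ω = y ∧ X ω = x)) :
    condMI μ M
      (fun ω => fun i : Fin n => if X ω i ∈ Y ω then some (F ω (X ω i)) else none)
      (fun ω => (Finset.univ.filter (fun i : Fin n => X ω i ∈ Y ω), X ω)) * Real.log 2
      ≤ δ * Real.log (Fintype.card κ) := by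
  rw [aux_condMI]
  set B : Ω → Fin n → Option Ans :=
    fun ω => fun i : Fin n => if X ω i ∈ Y ω then some (F ω (X ω i)) else none with hB
  set C : Ω → Finset (Fin n) × (Fin n → Q) :=
    fun ω => (Finset.univ.filter (fun i : Fin n => X ω i ∈ Y ω), X ω) with hC
  set Ψ : Ω → ℝ := fun ω =>
    Real.log (prEv μ (fun ω' => (M ω', B ω', C ω') = (M ω, B ω, C ω)))
      + Real.log (prEv μ (fun ω' => C ω' = C ω))
      - Real.log (prEv μ (fun ω' => (M ω', C ω') = (M ω, C ω)))
      - Real.log (prEv μ (fun ω' => (B ω', C ω') = (B ω, C ω))) with hΨ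
  have e0 : auxN μ (fun ω => (M ω, B ω, C ω)) + auxN μ C
      - auxN μ (fun ω => (M ω, C ω)) - auxN μ (fun ω => (B ω, C ω)) = ∑ ω, μ ω * Ψ ω := by
    unfold auxN
    rw [← Finset.sum_add_distrib, ← Finset.sum_sub_distrib, ← Finset.sum_sub_distrib]
    refine Finset.sum_congr rfl fun ω _ => ?_
    simp only [hΨ]
    ring
  rw [e0]
  set ν : (Fin n → Q) → Ω → ℝ := fun x => auxRes μ (fun ω => X ω = x) with hνdef
  have hν : ∀ x ω, 0 ≤ ν x ω := by
    intro x ω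
    simp only [hνdef, auxRes]
    split_ifs
    · exact hμ.1 ω
    · exact le_rfl
  have hνsum : ∀ ω, ∑ x, ν x ω = μ ω := by
    intro ω
    simp only [hνdef, auxRes]
    rw [Finset.sum_eq_single (X ω)]
    · simp
    · intro b _ hb
      rw [if_neg (fun h => hb h.symm)]
    · simp
  have hp : ∀ x, ∑ ω, ν x ω = prEv μ (fun ω => X ω = x) := by
    intro x; rfl
  have e1 : ∑ ω, μ ω * Ψ ω = ∑ x, ∑ ω, ν x ω * Ψ ω := by
    rw [Finset.sum_comm]
    refine Finset.sum_congr rfl fun ω _ => ?_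
    rw [← Finset.sum_mul, hνsum]
  have key : ∀ x, ∑ ω, ν x ω * Ψ ω
      ≤ δ * ((∑ ω, ν x ω) * Real.log (Fintype.card κ)) := by
    intro x
    have hpn : 0 ≤ ∑ ω, ν x ω := Finset.sum_nonneg fun ω _ => hν x ω
    rcases hpn.eq_or_lt with h0 | hpos
    · have hz : ∀ ω, ν x ω = 0 := fun ω =>
        (Finset.sum_eq_zero_iff_of_nonneg (fun ω _ => hν x ω)).1 h0.symm ω (Finset.mem_univ _)
      simp [hz]
    have hr : ∀ E : Ω → Prop, prEv (ν x) E = prEv μ (fun ω => E ω ∧ X ω = x) :=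
      fun E => aux_restrict μ (fun ω => X ω = x) E
    have hind : ∀ (u : (Q → Ans) × κ) (v : Finset Q),
        prEv (ν x) (fun ω => (F ω, M ω) = u ∧ Y ω = v) * (∑ ω, ν x ω)
        = prEv (ν x) (fun ω => (F ω, M ω) = u) * prEv (ν x) (fun ω => Y ω = v) := by
      rintro ⟨f, mm⟩ v
      rw [hr, hr, hr, hp]
      have := hcond x f mm v
      simpa only [Prod.mk.injEq, and_assoc] using this
    have hu : ∀ f, prEv (ν x) (fun ω => F ω = f)
        = (Fintype.card (Q → Ans) : ℝ)⁻¹ * prEv μ (fun ω => X ω = x) := by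
      intro f
      rw [hr, ← aux_pr_sum μ Y, ← aux_pr_sum μ Y (fun ω => X ω = x), Finset.mul_sum]
      refine Finset.sum_congr rfl fun y _ => ?_
      have := congrFun hF (f, x, y)
      simp only [rvDist, prodDist, Prod.mk.injEq] at this
      rw [aux_pr_congr μ (E' := fun ω => F ω = f ∧ X ω = x ∧ Y ω = y) (fun ω => by tauto), this,
        aux_pr_congr μ (E' := fun ω => Y ω = y ∧ X ω = x) (fun ω => by tauto)]
    set p := ∑ ω, ν x ω with hpdef
    set φ : (Q → Ans) × κ → Finset Q → ℝ := fun u y =>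
      Real.log (prEv (ν x) (fun ω' => (M ω', auxR (auxS x y) (F ω')) = (u.2, auxR (auxS x y) u.1)))
      + Real.log p - Real.log (prEv (ν x) (fun ω' => M ω' = u.2))
      - Real.log (prEv (ν x) (fun ω' => auxR (auxS x y) (F ω') = auxR (auxS x y) u.1)) with hφ
    have cA : ∑ ω, ν x ω * Ψ ω = ∑ ω, ν x ω * φ (F ω, M ω) (Y ω) := by
      refine Finset.sum_congr rfl fun ω _ => ?_
      rcases (hν x ω).eq_or_lt with h | h
      · rw [← h]; simp
      congr 1
      have hXx : X ω = x := by
        by_contra hne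
        simp [hνdef, auxRes, hne] at h
      have hiev := fun E E' => aux_indep_ev (ν x) (fun ω => (F ω, M ω)) Y hind E E'
      set t := prEv (ν x) (fun ω' => auxS x (Y ω') = auxS x (Y ω)) with ht
      have htpos : 0 < t := aux_pr_pos (hν x) ω h rfl
      have logl : ∀ a b : ℝ, 0 < b → a * p = b * t →
          Real.log a = Real.log b + Real.log t - Real.log p := by
        intro a b hb hab
        have : a = b * t / p := by field_simp; exact hab
        rw [this, Real.log_div (by positivity) (by positivity),
          Real.log_mul hb.ne' htpos.ne']
      have hCiff : ∀ ω', C ω' = C ω ↔ auxS x (Y ω') = auxS x (Y ω) ∧ X ω' = x := by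
        intro ω'
        simp only [hC, Prod.mk.injEq, hXx]
        constructor
        · rintro ⟨h1, h2⟩
          rw [h2] at h1
          exact ⟨(auxS_eq x _ _).1 h1, h2⟩
        · rintro ⟨h1, h2⟩
          rw [h2]
          exact ⟨(auxS_eq x _ _).2 h1, rfl⟩
      have hBiff : ∀ ω', auxS x (Y ω') = auxS x (Y ω) → X ω' = x →
          (B ω' = B ω ↔ auxR (auxS x (Y ω)) (F ω') = auxR (auxS x (Y ω)) (F ω)) := by
        intro ω' h1 h2
        simp only [hB, hXx, h2]
        exact auxB_eq x _ _ _ _ h1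
      have q1 : prEv μ (fun ω' => C ω' = C ω) = t := by
        rw [ht, hr]; exact aux_pr_congr μ hCiff
      have q2 := logl (prEv μ (fun ω' => (M ω', C ω') = (M ω, C ω)))
        (prEv (ν x) (fun ω' => M ω' = M ω)) (aux_pr_pos (hν x) ω h rfl) (by
          rw [ht, ← hiev (fun u => u.2 = M ω) (fun y => auxS x y = auxS x (Y ω)), hr]
          congr 1
          refine aux_pr_congr μ fun ω' => ?_
          rw [Prod.mk.injEq, hCiff]; tauto)
      have q3 := logl (prEv μ (fun ω' => (B ω', C ω') = (B ω, C ω)))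
        (prEv (ν x) (fun ω' => auxR (auxS x (Y ω)) (F ω') = auxR (auxS x (Y ω)) (F ω)))
        (aux_pr_pos (hν x) ω h rfl) (by
          rw [ht, ← hiev (fun u => auxR (auxS x (Y ω)) u.1 = auxR (auxS x (Y ω)) (F ω))
            (fun y => auxS x y = auxS x (Y ω)), hr]
          congr 1
          refine aux_pr_congr μ fun ω' => ?_
          rw [Prod.mk.injEq, hCiff]
          have := hBiff ω'
          tauto)
      have q4 := logl (prEv μ (fun ω' => (M ω', B ω', C ω') = (M ω, B ω, C ω)))
        (prEv (ν x) (fun ω' => (M ω', auxR (auxS x (Y ω)) (F ω'))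
          = (M ω, auxR (auxS x (Y ω)) (F ω))))
        (aux_pr_pos (hν x) ω h rfl) (by
          rw [ht, ← hiev (fun u => (u.2, auxR (auxS x (Y ω)) u.1)
              = (M ω, auxR (auxS x (Y ω)) (F ω)))
            (fun y => auxS x y = auxS x (Y ω)), hr]
          congr 1
          refine aux_pr_congr μ fun ω' => ?_
          have := hBiff ω'
          have h3 := hCiff ω'
          have h4 : ((M ω', B ω', C ω') = (M ω, B ω, C ω)) ↔ (M ω' = M ω ∧ B ω' = B ω ∧ C ω' = C ω) := by
            rw [Prod.mk.injEq, Prod.mk.injEq]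
          rw [h4, h3, Prod.mk.injEq]
          tauto)
      simp only [hΨ, hφ]
      rw [q1, q2, q3, q4]
      ring
    have cB := aux_indep (ν x) (fun ω => (F ω, M ω)) Y hind φ
    have hw := aux_g_bound (hν x) F M _ hu (fun ω => ν x ω / p)
      (fun ω => div_nonneg (hν x ω) hpn) (fun ω => auxS x (Y ω)) δ hδ (by
        intro q
        have hd : prEv (fun ω => ν x ω / p) (fun ω => q ∈ auxS x (Y ω))
            = prEv (ν x) (fun ω => q ∈ auxS x (Y ω)) / p := by
          unfold prEv
          rw [Finset.sum_div]
          refine Finset.sum_congr rfl fun ω _ => ?_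
          split_ifs <;> simp
        rw [hd, div_le_iff₀ hpos, hr]
        by_cases hq : ∃ i, x i = q
        · obtain ⟨i, rfl⟩ := hq
          rw [hpdef, hp]
          refine le_trans (aux_pr_mono hμ.1 ?_) (hlight x i)
          rintro ω ⟨h1, h2⟩
          exact ⟨h2, ((auxS_mem _ _ _).1 h1).1⟩
        · have : prEv μ (fun ω => q ∈ auxS x (Y ω) ∧ X ω = x) = 0 := by
            unfold prEv
            refine Finset.sum_eq_zero fun ω _ => ?_
            rw [if_neg]
            rintro ⟨h1, -⟩
            exact hq ((auxS_mem _ _ _).1 h1).2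
          rw [this]
          exact mul_nonneg hδ hpn)
    refine le_trans (le_of_eq ?_) hw
    rw [cA, ← mul_right_cancel_iff_of_pos hpos, cB, Finset.sum_mul]
    refine Finset.sum_congr rfl fun ω' _ => ?_
    have hinner : ∑ ω, ν x ω * φ (F ω, M ω) (Y ω')
        = auxN (ν x) (fun ω => (M ω, auxR (auxS x (Y ω')) (F ω))) + p * Real.log p
          - auxN (ν x) M - auxN (ν x) (fun ω => auxR (auxS x (Y ω')) (F ω)) := by
      unfold auxN
      rw [hpdef, Finset.sum_mul, ← Finset.sum_add_distrib, ← Finset.sum_sub_distrib,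
        ← Finset.sum_sub_distrib]
      refine Finset.sum_congr rfl fun ω _ => ?_
      simp only [hφ]
      ring
    rw [hinner, ← hpdef]
    field_simp
  rw [e1]
  refine (Finset.sum_le_sum fun x _ => key x).trans ?_
  rw [← Finset.mul_sum, ← Finset.sum_mul, Finset.sum_comm]
  simp_rw [hνsum]
  rw [hμ.2, one_mul]

/-- Shearer-type bound for light intersections: if `F` is a uniformly random oracle
independent of `(X,Y)`, `M₁ = m1fun(X, F(X), R)` is a randomized function of `(X, F(X))`
(with independent randomness `R`), every query is in the intersection
`T = {i : X i ∈ Y}` with probability at most `δ` conditioned on `X`, and `Y` is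
independent of `(F, M₁)` given `X`, then `I(M₁; F(X_T) | T, X) ≤ δ·|M₁|`. -/
theorem shearer_light_intersection {Ω Q Ans ρ : Type*} {n m : ℕ}
    [Fintype Ω] [Fintype Q] [Fintype Ans] [Fintype ρ]
    (μ : Ω → ℝ) (hμ : IsPMF μ)
    (X : Ω → Fin n → Q) (Y : Ω → Finset Q) (F : Ω → Q → Ans) (R : Ω → ρ)
    (m1fun : (Fin n → Q) → (Fin n → Ans) → ρ → (Fin m → Bool))
    (δ : ℝ) (hδ : 0 ≤ δ)
    -- F is a uniformly random function, independent of (X, Y)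
    (hF : rvDist μ (fun ω => (F ω, (X ω, Y ω))) =
        prodDist (fun _ => ((Fintype.card (Q → Ans) : ℝ))⁻¹)
          (rvDist μ (fun ω => (X ω, Y ω))))
    -- the internal randomness R of M₁ is independent of (X, Y, F)
    (hR : rvDist μ (fun ω => (R ω, (X ω, Y ω, F ω))) =
        prodDist (rvDist μ R) (rvDist μ (fun ω => (X ω, Y ω, F ω))))
    -- every individual query is an intersection query with probability ≤ δ given X = x
    (hlight : ∀ (x : Fin n → Q) (i : Fin n),
        prEv μ (fun ω => X ω = x ∧ x i ∈ Y ω) ≤ δ * prEv μ (fun ω => X ω = x))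
    -- Y is independent of (F, M₁) given X
    (hcond : ∀ (x : Fin n → Q) (f : Q → Ans) (mm : Fin m → Bool) (y : Finset Q),
        prEv μ (fun ω => F ω = f ∧ m1fun (X ω) (fun i => F ω (X ω i)) (R ω) = mm ∧
            Y ω = y ∧ X ω = x) * prEv μ (fun ω => X ω = x)
          = prEv μ (fun ω => F ω = f ∧ m1fun (X ω) (fun i => F ω (X ω i)) (R ω) = mm ∧
              X ω = x) * prEv μ (fun ω => Y ω = y ∧ X ω = x)) :
    condMI μ (fun ω => m1fun (X ω) (fun i => F ω (X ω i)) (R ω))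
      (fun ω => fun i : Fin n => if X ω i ∈ Y ω then some (F ω (X ω i)) else none)
      (fun ω => (Finset.univ.filter (fun i : Fin n => X ω i ∈ Y ω), X ω))
      ≤ δ * m := by
  have h := aux_main μ hμ X Y F (fun ω => m1fun (X ω) (fun i => F ω (X ω i)) (R ω)) δ hδ hF
    hlight hcond
  have h2 : 0 < Real.log 2 := Real.log_pos one_lt_two
  have hc : Real.log (Fintype.card (Fin m → Bool)) = m * Real.log 2 := by
    simp
  rw [hc, ← mul_assoc] at h
  exact le_of_mul_le_mul_right h h2
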